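/- Suppose the form a admits a null state φ which is a positive classical solution of Lφ = 0 in Ω, and fix x₀ ∈ Ω. Then there exists a sequence of compactly supported Lipschitz functions u_N : Ω → ℝ such that a[u_N] → 0 (the form being evaluated using the almost-everywhere defined gradient of u_N) and u_N → φ locally uniformly on Ω ∖ {x₀}. -/

import Mathlib

open MeasureTheory Set Filter Topology

noncomputable section

/-- `u` is a real-valued smooth function compactly supported in `Ω`. -/
def IsSmoothCS {d : ℕ} (Ω : Set (EuclideanSpace ℝ (Fin d)))
    (u : EuclideanSpace ℝ (Fin d) → ℝ) : Prop :=
  ContDiff ℝ (⊤ : ℕ∞) u ∧ HasCompactSupport u ∧ tsupport u ⊆ Ω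

/-- The quadratic form `a[u] = ∫_Ω (A ∇u · ∇u + V u²) dx`. -/
def quadForm {d : ℕ} (Ω : Set (EuclideanSpace ℝ (Fin d)))
    (A : EuclideanSpace ℝ (Fin d) → Matrix (Fin d) (Fin d) ℝ)
    (V : EuclideanSpace ℝ (Fin d) → ℝ)
    (u : EuclideanSpace ℝ (Fin d) → ℝ) : ℝ :=
  ∫ x in Ω, ((∑ i, ∑ j, A x i j * gradient u x i * gradient u x j) + V x * (u x) ^ 2)

/-- Convergence in `L²_loc(Ω)`. -/
def TendstoL2loc {d : ℕ} (Ω : Set (EuclideanSpace ℝ (Fin d)))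
    (φk : ℕ → EuclideanSpace ℝ (Fin d) → ℝ) (φ : EuclideanSpace ℝ (Fin d) → ℝ) : Prop :=
  ∀ K : Set (EuclideanSpace ℝ (Fin d)), K ⊆ Ω → IsCompact K →
    Tendsto (fun k => ∫ x in K, (φk k x - φ x) ^ 2) atTop (nhds 0)

/-- `φ` is a null state for the form `a`: `φ ∈ L²_loc(Ω)`, `φ > 0` a.e. in `Ω`, and some
null sequence (`a[φ_k] → 0`) of test functions converges to `φ` in `L²_loc(Ω)`. -/
def IsNullState {d : ℕ} (Ω : Set (EuclideanSpace ℝ (Fin d)))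
    (A : EuclideanSpace ℝ (Fin d) → Matrix (Fin d) (Fin d) ℝ)
    (V : EuclideanSpace ℝ (Fin d) → ℝ)
    (φ : EuclideanSpace ℝ (Fin d) → ℝ) : Prop :=
  (∀ K : Set (EuclideanSpace ℝ (Fin d)), K ⊆ Ω → IsCompact K →
      IntegrableOn (fun x => (φ x) ^ 2) K) ∧
  (∀ᵐ x ∂(volume.restrict Ω), 0 < φ x) ∧
  ∃ φk : ℕ → EuclideanSpace ℝ (Fin d) → ℝ,
    (∀ k, IsSmoothCS Ω (φk k)) ∧
    Tendsto (fun k => quadForm Ω A V (φk k)) atTop (nhds 0) ∧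
    TendstoL2loc Ω φk φ

/-- The form `a` has a weighted spectral gap: a continuous `W > 0` on `Ω` with
`∫_Ω W u² ≤ a[u]` for all test functions. -/
def HasWeightedSpectralGap {d : ℕ} (Ω : Set (EuclideanSpace ℝ (Fin d)))
    (A : EuclideanSpace ℝ (Fin d) → Matrix (Fin d) (Fin d) ℝ)
    (V : EuclideanSpace ℝ (Fin d) → ℝ) : Prop :=
  ∃ W : EuclideanSpace ℝ (Fin d) → ℝ, ContinuousOn W Ω ∧ (∀ x ∈ Ω, 0 < W x) ∧
    ∀ u, IsSmoothCS Ω u → ∫ x in Ω, W x * (u x) ^ 2 ≤ quadForm Ω A V u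

/-- The Schrödinger operator `L u = -div(A ∇u) + V u`, evaluated pointwise. -/
def Lop {d : ℕ} (A : EuclideanSpace ℝ (Fin d) → Matrix (Fin d) (Fin d) ℝ)
    (V : EuclideanSpace ℝ (Fin d) → ℝ) (u : EuclideanSpace ℝ (Fin d) → ℝ)
    (x : EuclideanSpace ℝ (Fin d)) : ℝ :=
  -(∑ i, fderiv ℝ (fun y => ∑ j, A y i j * gradient u y j) x (EuclideanSpace.single i 1)) +
    V x * u x

/-- The quadratic form of a matrix. -/
def matForm {d : ℕ} (M : Matrix (Fin d) (Fin d) ℝ) (ξ : EuclideanSpace ℝ (Fin d)) : ℝ :=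
  ∑ i, ∑ j, M i j * ξ i * ξ j

theorem matForm_smul {d : ℕ} (M : Matrix (Fin d) (Fin d) ℝ) (c : ℝ)
    (ξ : EuclideanSpace ℝ (Fin d)) : matForm M (c • ξ) = c ^ 2 * matForm M ξ := by
  simp only [matForm, PiLp.smul_apply, smul_eq_mul, Finset.mul_sum]
  refine Finset.sum_congr rfl fun i _ => Finset.sum_congr rfl fun j _ => ?_
  ring

theorem matForm_add_le {d : ℕ} {M : Matrix (Fin d) (Fin d) ℝ} (hM : ∀ ξ, 0 ≤ matForm M ξ)
    (ξ η : EuclideanSpace ℝ (Fin d)) :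
    matForm M (ξ + η) ≤ 2 * matForm M ξ + 2 * matForm M η := by
  have h : matForm M (ξ + η) + matForm M (ξ - η) = 2 * matForm M ξ + 2 * matForm M η := by
    simp only [matForm, PiLp.add_apply, PiLp.sub_apply, Finset.mul_sum,
      ← Finset.sum_add_distrib]
    refine Finset.sum_congr rfl fun i _ => Finset.sum_congr rfl fun j _ => ?_
    ring
  linarith [hM (ξ - η)]

theorem matForm_smul_add_smul {d : ℕ} {M : Matrix (Fin d) (Fin d) ℝ} (hM : M.IsSymm)
    (a b : ℝ) (ξ η : EuclideanSpace ℝ (Fin d)) :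
    matForm M (a • ξ + b • η) =
      a ^ 2 * matForm M ξ + ∑ i, (∑ j, M i j * η j) * (2 * a * b * ξ i + b ^ 2 * η i) := by
  have hsymm : ∑ i, ∑ j, M i j * η i * ξ j = ∑ i, ∑ j, M i j * ξ i * η j := by
    rw [Finset.sum_comm]
    refine Finset.sum_congr rfl fun i _ => Finset.sum_congr rfl fun j _ => ?_
    rw [hM.apply i j]
    ring
  have hexp : matForm M (a • ξ + b • η) = a ^ 2 * matForm M ξ
      + a * b * (∑ i, ∑ j, M i j * ξ i * η j) + a * b * (∑ i, ∑ j, M i j * η i * ξ j)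
      + b ^ 2 * matForm M η := by
    simp only [matForm, PiLp.add_apply, PiLp.smul_apply, smul_eq_mul, Finset.mul_sum,
      ← Finset.sum_add_distrib]
    refine Finset.sum_congr rfl fun i _ => Finset.sum_congr rfl fun j _ => ?_
    ring
  rw [hexp, hsymm]
  simp only [matForm, Finset.mul_sum, Finset.sum_mul, ← Finset.sum_add_distrib]
  refine Finset.sum_congr rfl fun i _ => Finset.sum_congr rfl fun j _ => ?_
  ring

theorem gradient_apply {d : ℕ} (u : EuclideanSpace ℝ (Fin d) → ℝ)
    (x : EuclideanSpace ℝ (Fin d)) (i : Fin d) :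
    gradient u x i = fderiv ℝ u x (EuclideanSpace.single i 1) := by
  rw [← toDual_gradient, InnerProductSpace.toDual_apply_apply,
    EuclideanSpace.inner_single_right]
  simp

theorem gradient_fun_mul {d : ℕ} {f g : EuclideanSpace ℝ (Fin d) → ℝ}
    {x : EuclideanSpace ℝ (Fin d)} (hf : DifferentiableAt ℝ f x) (hg : DifferentiableAt ℝ g x) :
    gradient (fun y => f y * g y) x = f x • gradient g x + g x • gradient f x := by
  ext i
  simp [gradient_apply, fderiv_fun_mul hf hg]

theorem gradient_eq_zero_of_notMem_tsupport {d : ℕ} {f : EuclideanSpace ℝ (Fin d) → ℝ}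
    {x : EuclideanSpace ℝ (Fin d)} (hx : x ∉ tsupport f) : gradient f x = 0 := by
  ext i
  rw [gradient_apply, fderiv_of_notMem_tsupport ℝ hx]
  simp

theorem ContDiffOn.gradient_coord {d : ℕ} {Ω : Set (EuclideanSpace ℝ (Fin d))} (hΩ : IsOpen Ω)
    {m n : WithTop ℕ∞} (hmn : m + 1 ≤ n) {f : EuclideanSpace ℝ (Fin d) → ℝ}
    (hf : ContDiffOn ℝ n f Ω) (i : Fin d) : ContDiffOn ℝ m (fun x => gradient f x i) Ω := by
  simp only [gradient_apply]
  exact (hf.fderiv_of_isOpen hΩ hmn).clm_apply contDiffOn_const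

theorem ContinuousOn.matForm {d : ℕ} {Ω : Set (EuclideanSpace ℝ (Fin d))}
    {A : EuclideanSpace ℝ (Fin d) → Matrix (Fin d) (Fin d) ℝ}
    (hA : ∀ i j, ContinuousOn (fun x => A x i j) Ω)
    {ξ : EuclideanSpace ℝ (Fin d) → EuclideanSpace ℝ (Fin d)}
    (hξ : ∀ i, ContinuousOn (fun x => ξ x i) Ω) :
    ContinuousOn (fun x => _root_.matForm (A x) (ξ x)) Ω :=
  continuousOn_finsetSum _ fun i _ => continuousOn_finsetSum _ fun j _ =>
    ((hA i j).mul (hξ i)).mul (hξ j)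

theorem integrable_of_continuousOn_isCompact {X : Type*} [TopologicalSpace X] [T2Space X]
    [MeasurableSpace X] [OpensMeasurableSpace X] {μ : Measure X} [IsFiniteMeasureOnCompacts μ]
    {K : Set X} (hK : IsCompact K) {f : X → ℝ} (hf : ContinuousOn f K)
    (h0 : ∀ x ∉ K, f x = 0) : Integrable f μ := by
  refine (integrableOn_iff_integrable_of_support_subset (s := K) ?_).1
    (hf.integrableOn_compact hK)
  intro x hx
  by_contra hxK
  exact hx (h0 x hxK)

theorem ContDiffOn.contDiff_mul_of_tsupport_subset {E : Type*} [NormedAddCommGroup E]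
    [NormedSpace ℝ E] {n : WithTop ℕ∞} {Ω : Set E} (hΩ : IsOpen Ω) {f w : E → ℝ}
    (hf : ContDiffOn ℝ n f Ω) (hw : ContDiff ℝ n w) (hwΩ : tsupport w ⊆ Ω) :
    ContDiff ℝ n (fun x => f x * w x) := by
  refine contDiff_iff_contDiffAt.2 fun x => ?_
  by_cases hx : x ∈ tsupport w
  · exact (hf.contDiffAt (hΩ.mem_nhds (hwΩ hx))).mul hw.contDiffAt
  · have h0 : (fun y => f y * w y) =ᶠ[𝓝 x] fun _ => 0 := by
      filter_upwards [notMem_tsupport_iff_eventuallyEq.1 hx] with y hy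
      simp [hy]
    exact contDiffAt_const.congr_of_eventuallyEq h0

theorem integral_fderiv_apply_eq_zero {E : Type*} [NormedAddCommGroup E] [NormedSpace ℝ E]
    [MeasurableSpace E] [BorelSpace E] [FiniteDimensional ℝ E] (μ : Measure E)
    [μ.IsAddHaarMeasure] {f : E → ℝ} (hf : ContDiff ℝ 1 f) (hfs : HasCompactSupport f) (v : E) :
    ∫ x, fderiv ℝ f x v ∂μ = 0 := by
  have hint : Integrable (fun x => fderiv ℝ f x v) μ :=
    ((hf.continuous_fderiv one_ne_zero).clm_apply continuous_const).integrable_of_hasCompactSupport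
      (hfs.fderiv_apply ℝ v)
  have hfint : Integrable f μ := hf.continuous.integrable_of_hasCompactSupport hfs
  have h := integral_mul_fderiv_eq_neg_fderiv_mul_of_integrable (𝕜 := ℝ) (μ := μ)
    (f := fun _ : E => (1 : ℝ)) (g := f) (v := v) (by simp) (by simpa using hint)
    (by simpa using hfint) (fun x _ => differentiableAt_const _)
    (fun x _ => hf.differentiable one_ne_zero x)
  simpa using h

theorem exists_contDiff_one_on_compact {E : Type*} [NormedAddCommGroup E] [NormedSpace ℝ E]
    [FiniteDimensional ℝ E] {K Ω : Set E} (hK : IsCompact K) (hΩ : IsOpen Ω) (hKΩ : K ⊆ Ω) :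
    ∃ η : E → ℝ, ContDiff ℝ 1 η ∧ HasCompactSupport η ∧ tsupport η ⊆ Ω ∧
      (∀ x ∈ K, η x = 1) ∧ ∀ x, η x ∈ Icc (0 : ℝ) 1 := by
  have : ProperSpace E := FiniteDimensional.proper ℝ E
  obtain ⟨L, hL, hKL, hLΩ⟩ := exists_compact_between hK hΩ hKΩ
  obtain ⟨η, h1, h0, h01⟩ := exists_contMDiffMap_one_nhds_of_subset_interior
    (modelWithCornersSelf ℝ E) (n := 1) hK.isClosed hKL
  have hsupp : tsupport η ⊆ L := closure_minimal
    (fun x hx => by by_contra hxL; exact hx (h0 x hxL)) hL.isClosed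
  exact ⟨η, η.contMDiff.contDiff, hL.of_isClosed_subset (isClosed_tsupport _) hsupp,
    hsupp.trans hLΩ, fun x hx => h1.self_of_nhdsSet x hx, h01⟩

theorem integrable_sq_mul_matForm_gradient {d : ℕ} {Ω : Set (EuclideanSpace ℝ (Fin d))}
    {A : EuclideanSpace ℝ (Fin d) → Matrix (Fin d) (Fin d) ℝ}
    (hA : ∀ i j, ContinuousOn (fun x => A x i j) Ω)
    {φ w : EuclideanSpace ℝ (Fin d) → ℝ} (hφ : ContinuousOn φ Ω)
    (hw : ContDiff ℝ 1 w) (hws : HasCompactSupport w) (hwΩ : tsupport w ⊆ Ω) :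
    Integrable (fun x => φ x ^ 2 * matForm (A x) (gradient w x)) := by
  refine integrable_of_continuousOn_isCompact hws
    (((hφ.pow 2).mul (ContinuousOn.matForm hA fun i => ?_)).mono hwΩ) fun x hx => ?_
  · exact ((hw.contDiffOn.gradient_coord isOpen_univ (m := 0) (by simp) i).continuousOn).mono
      (subset_univ _)
  · simp [gradient_eq_zero_of_notMem_tsupport hx, matForm]

/-- The ground state representation of the form `a` with respect to a positive solution. -/
theorem quadForm_mul_eq {d : ℕ} {Ω : Set (EuclideanSpace ℝ (Fin d))} (hΩ : IsOpen Ω)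
    {A : EuclideanSpace ℝ (Fin d) → Matrix (Fin d) (Fin d) ℝ}
    (hA : ∀ i j, ContDiffOn ℝ 1 (fun x => A x i j) Ω) (hsymm : ∀ x ∈ Ω, (A x).IsSymm)
    {V φ w : EuclideanSpace ℝ (Fin d) → ℝ} (hφ : ContDiffOn ℝ 2 φ Ω)
    (hsol : ∀ x ∈ Ω, Lop A V φ x = 0)
    (hw : ContDiff ℝ 1 w) (hws : HasCompactSupport w) (hwΩ : tsupport w ⊆ Ω) :
    quadForm Ω A V (fun x => φ x * w x) =
      ∫ x in Ω, φ x ^ 2 * matForm (A x) (gradient w x) := by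
  set G : Fin d → EuclideanSpace ℝ (Fin d) → ℝ := fun i y => ∑ j, A y i j * gradient φ y j
    with hGdef
  have hG : ∀ i, ContDiffOn ℝ 1 (G i) Ω := fun i => ContDiffOn.sum fun j _ =>
    (hA i j).mul (hφ.gradient_coord hΩ (by norm_num) j)
  have hφ1 : ContDiffOn ℝ 1 φ Ω := hφ.of_le (by norm_num)
  set F : Fin d → EuclideanSpace ℝ (Fin d) → ℝ := fun i y => (G i y * φ y * w y) * w y with hFdef
  have hF : ∀ i, ContDiff ℝ 1 (F i) := fun i =>
    (((hG i).mul hφ1).contDiff_mul_of_tsupport_subset hΩ hw hwΩ).mul hw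
  have hFsupp : ∀ i, tsupport (F i) ⊆ tsupport w := fun i => tsupport_mul_subset_right
  have hFs : ∀ i, HasCompactSupport (F i) := fun i => hws.mul_left
  have hdivint : ∀ i, Integrable fun x => fderiv ℝ (F i) x (EuclideanSpace.single i 1) := fun i =>
    (((hF i).continuous_fderiv one_ne_zero).clm_apply
      continuous_const).integrable_of_hasCompactSupport ((hFs i).fderiv_apply ℝ _)
  have hdiv0 : ∫ x in Ω, ∑ i, fderiv ℝ (F i) x (EuclideanSpace.single i 1) = 0 := by
    rw [setIntegral_eq_integral_of_forall_compl_eq_zero, integral_finsetSum _ fun i _ => hdivint i]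
    · exact Finset.sum_eq_zero fun i _ => integral_fderiv_apply_eq_zero _ (hF i) (hFs i) _
    · intro x hx
      refine Finset.sum_eq_zero fun i _ => ?_
      rw [fderiv_of_notMem_tsupport ℝ fun h => hx (hwΩ (hFsupp i h))]
      simp
  have hpt : ∀ x ∈ Ω, (∑ i, ∑ j, A x i j * gradient (fun x => φ x * w x) x i *
        gradient (fun x => φ x * w x) x j) + V x * (φ x * w x) ^ 2 =
      φ x ^ 2 * matForm (A x) (gradient w x) +
        ∑ i, fderiv ℝ (F i) x (EuclideanSpace.single i 1) := by
    intro x hx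
    have hφx : DifferentiableAt ℝ φ x :=
      (hφ1.contDiffAt (hΩ.mem_nhds hx)).differentiableAt one_ne_zero
    have hwx : DifferentiableAt ℝ w x := hw.differentiable one_ne_zero x
    have hGx : ∀ i, DifferentiableAt ℝ (G i) x := fun i =>
      ((hG i).contDiffAt (hΩ.mem_nhds hx)).differentiableAt one_ne_zero
    have hFx : ∀ i, fderiv ℝ (F i) x (EuclideanSpace.single i 1) =
        φ x * w x ^ 2 * fderiv ℝ (G i) x (EuclideanSpace.single i 1) +
        G i x * (2 * φ x * w x * gradient w x i + w x ^ 2 * gradient φ x i) := by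
      intro i
      rw [hFdef]
      simp only []
      rw [fderiv_fun_mul (((hGx i).fun_mul hφx).fun_mul hwx) hwx,
        fderiv_fun_mul ((hGx i).fun_mul hφx) hwx, fderiv_fun_mul (hGx i) hφx]
      simp only [gradient_apply, add_apply, smul_apply,
        smul_eq_mul]
      ring
    have hL := hsol x hx
    simp only [Lop] at hL
    change matForm (A x) (gradient (fun x => φ x * w x) x) + _ = _
    rw [gradient_fun_mul hφx hwx, matForm_smul_add_smul (hsymm x hx),
      Finset.sum_congr rfl fun i _ => hFx i, Finset.sum_add_distrib, ← Finset.mul_sum]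
    have hLG : ∑ i, fderiv ℝ (G i) x (EuclideanSpace.single i 1) = V x * φ x := by
      linarith
    rw [hLG]
    ring
  rw [quadForm, setIntegral_congr_fun hΩ.measurableSet hpt, integral_add, hdiv0, add_zero]
  · exact (integrable_sq_mul_matForm_gradient (fun i j => (hA i j).continuousOn) hφ.continuousOn
      hw hws hwΩ).integrableOn
  · exact (integrable_finsetSum _ fun i _ => hdivint i).integrableOn

/-- Interpolating a null sequence with the null state itself on a compact set `K` yields test
functions of arbitrarily small energy which agree with the null state on `K`. -/
theorem exists_eqOn_abs_quadForm_lt {d : ℕ} {Ω : Set (EuclideanSpace ℝ (Fin d))} (hΩ : IsOpen Ω)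
    {A : EuclideanSpace ℝ (Fin d) → Matrix (Fin d) (Fin d) ℝ}
    (hA : ∀ i j, ContDiffOn ℝ 1 (fun x => A x i j) Ω) (hsymm : ∀ x ∈ Ω, (A x).IsSymm)
    (hpos : ∀ x ∈ Ω, ∀ ξ, 0 ≤ matForm (A x) ξ)
    {V φ : EuclideanSpace ℝ (Fin d) → ℝ} (hnull : IsNullState Ω A V φ)
    (hφ : ContDiffOn ℝ 2 φ Ω) (hφpos : ∀ x ∈ Ω, 0 < φ x) (hsol : ∀ x ∈ Ω, Lop A V φ x = 0)
    {K : Set (EuclideanSpace ℝ (Fin d))} (hK : IsCompact K) (hKΩ : K ⊆ Ω)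
    {ε : ℝ} (hε : 0 < ε) :
    ∃ u : EuclideanSpace ℝ (Fin d) → ℝ, ContDiff ℝ 1 u ∧ HasCompactSupport u ∧ tsupport u ⊆ Ω ∧
      EqOn u φ K ∧ |quadForm Ω A V u| < ε := by
  obtain ⟨η, hη, hηs, hηΩ, hη1, hη01⟩ := exists_contDiff_one_on_compact hK hΩ hKΩ
  obtain ⟨-, -, ψ, hψ, hψa, hψL⟩ := hnull
  have hAc : ∀ i j, ContinuousOn (fun x => A x i j) Ω := fun i j => (hA i j).continuousOn
  have hφ1 : ContDiffOn ℝ 1 φ Ω := hφ.of_le (by norm_num)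
  have hηgrad : ContinuousOn (fun x => matForm (A x) (gradient η x)) Ω :=
    ContinuousOn.matForm hAc fun i =>
      ((hη.contDiffOn.gradient_coord isOpen_univ (m := 0) (by simp) i).continuousOn).mono
        (subset_univ _)
  obtain ⟨C, hC⟩ := hηs.isCompact.exists_bound_of_continuousOn (hηgrad.mono hηΩ)
  set w : ℕ → EuclideanSpace ℝ (Fin d) → ℝ := fun k x => (φ x)⁻¹ * ψ k x with hwdef
  have hψ1 : ∀ k, ContDiff ℝ 1 (ψ k) := fun k => (hψ k).1.of_le (by simp)
  have hw : ∀ k, ContDiff ℝ 1 (w k) := fun k =>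
    (hφ1.inv fun x hx => (hφpos x hx).ne').contDiff_mul_of_tsupport_subset hΩ (hψ1 k) (hψ k).2.2
  have hws : ∀ k, HasCompactSupport (w k) := fun k => (hψ k).2.1.mul_left
  have hwΩ : ∀ k, tsupport (w k) ⊆ Ω := fun k => tsupport_mul_subset_right.trans (hψ k).2.2
  have hφw : ∀ k, (fun x => φ x * w k x) = ψ k := by
    intro k
    ext x
    by_cases hx : x ∈ Ω
    · rw [hwdef]
      field_simp [(hφpos x hx).ne']
    · simp [hwdef, image_eq_zero_of_notMem_tsupport fun h => hx ((hψ k).2.2 h)]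
  have hE : ∀ k, quadForm Ω A V (ψ k) =
      ∫ x in Ω, φ x ^ 2 * matForm (A x) (gradient (w k) x) := fun k => by
    rw [← hφw k, quadForm_mul_eq hΩ hA hsymm hφ hsol (hw k) (hws k) (hwΩ k)]
  set z : ℕ → EuclideanSpace ℝ (Fin d) → ℝ := fun k x => w k x + η x * (1 - w k x) with hzdef
  have hz : ∀ k, ContDiff ℝ 1 (z k) := fun k =>
    (hw k).add (hη.mul (contDiff_const.sub (hw k)))
  have hzs : ∀ k, HasCompactSupport (z k) := fun k => (hws k).add hηs.mul_right
  have hzΩ : ∀ k, tsupport (z k) ⊆ Ω := fun k =>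
    (tsupport_add _ _).trans (union_subset (hwΩ k) (tsupport_mul_subset_left.trans hηΩ))
  have hbound : ∀ k, ∀ x ∈ Ω, φ x ^ 2 * matForm (A x) (gradient (z k) x) ≤
      2 * (φ x ^ 2 * matForm (A x) (gradient (w k) x)) +
        2 * C * (tsupport η).indicator (fun x => (ψ k x - φ x) ^ 2) x := by
    intro k x hx
    have hwx : DifferentiableAt ℝ (w k) x := (hw k).differentiable one_ne_zero x
    have hηx : DifferentiableAt ℝ η x := hη.differentiable one_ne_zero x
    have hgrad : gradient (z k) x =
        (1 - η x) • gradient (w k) x + (1 - w k x) • gradient η x := by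
      ext i
      simp only [gradient_apply, hzdef, PiLp.add_apply, PiLp.smul_apply]
      rw [fderiv_fun_add hwx (hηx.fun_mul (hwx.const_sub 1)),
        fderiv_fun_mul hηx (hwx.const_sub 1), fderiv_const_sub]
      simp
      ring
    have h1 := matForm_add_le (hpos x hx) ((1 - η x) • gradient (w k) x)
      ((1 - w k x) • gradient η x)
    rw [← hgrad, matForm_smul, matForm_smul] at h1
    have hη2 : (1 - η x) ^ 2 ≤ 1 := by nlinarith [(hη01 x).1, (hη01 x).2]
    have h2 := mul_le_mul_of_nonneg_right hη2 (hpos x hx (gradient (w k) x))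
    have h3 : φ x ^ 2 * ((1 - w k x) ^ 2 * matForm (A x) (gradient η x)) ≤
        C * (tsupport η).indicator (fun x => (ψ k x - φ x) ^ 2) x := by
      by_cases hxη : x ∈ tsupport η
      · rw [indicator_of_mem hxη, ← congrFun (hφw k) x]
        have h4 := mul_le_mul_of_nonneg_left ((le_abs_self _).trans (hC x hxη))
          (sq_nonneg (φ x * w k x - φ x))
        linarith
      · simp [gradient_eq_zero_of_notMem_tsupport hxη, matForm, hxη]
    have h5 := mul_le_mul_of_nonneg_left h1 (sq_nonneg (φ x))
    have h6 := mul_le_mul_of_nonneg_left h2 (sq_nonneg (φ x))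
    linarith
  have hint : ∀ k, IntegrableOn (fun x => (ψ k x - φ x) ^ 2) (tsupport η) := fun k =>
    ((((hψ1 k).continuous.continuousOn.sub hφ.continuousOn).pow 2).mono
      hηΩ).integrableOn_compact hηs
  have hle : ∀ k, quadForm Ω A V (fun x => φ x * z k x) ≤
      2 * quadForm Ω A V (ψ k) + 2 * C * ∫ x in tsupport η, (ψ k x - φ x) ^ 2 := by
    intro k
    have hηm : MeasurableSet (tsupport η) := (isClosed_tsupport η).measurableSet
    have hi1 : IntegrableOn (fun x => 2 * (φ x ^ 2 * matForm (A x) (gradient (w k) x))) Ω :=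
      ((integrable_sq_mul_matForm_gradient hAc hφ.continuousOn (hw k) (hws k)
        (hwΩ k)).const_mul 2).integrableOn
    have hi2 : IntegrableOn
        (fun x => 2 * C * (tsupport η).indicator (fun x => (ψ k x - φ x) ^ 2) x) Ω :=
      (((integrable_indicator_iff hηm).2 (hint k)).const_mul (2 * C)).integrableOn
    have hi0 : IntegrableOn (fun x => φ x ^ 2 * matForm (A x) (gradient (z k) x)) Ω :=
      (integrable_sq_mul_matForm_gradient hAc hφ.continuousOn (hz k) (hzs k)
        (hzΩ k)).integrableOn
    rw [quadForm_mul_eq hΩ hA hsymm hφ hsol (hz k) (hzs k) (hzΩ k), hE]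
    refine (setIntegral_mono_on hi0 (hi1.add hi2) hΩ.measurableSet (hbound k)).trans_eq ?_
    simp only [Pi.add_apply]
    rw [integral_add hi1 hi2, integral_const_mul, integral_const_mul,
      setIntegral_indicator hηm, inter_eq_self_of_subset_right hηΩ]
  have hlim : Tendsto (fun k => 2 * quadForm Ω A V (ψ k) +
      2 * C * ∫ x in tsupport η, (ψ k x - φ x) ^ 2) atTop (nhds 0) := by
    simpa using (hψa.const_mul 2).add ((hψL _ hηΩ hηs).const_mul (2 * C))
  obtain ⟨k, hk⟩ := (hlim.eventually_lt_const hε).exists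
  refine ⟨fun x => φ x * z k x, hφ1.contDiff_mul_of_tsupport_subset hΩ (hz k) (hzΩ k),
    (hzs k).mul_left, tsupport_mul_subset_right.trans (hzΩ k), fun x hx => ?_, ?_⟩
  · simp [hzdef, hη1 x hx]
  · rw [abs_of_nonneg]
    · exact (hle k).trans_lt hk
    · rw [quadForm_mul_eq hΩ hA hsymm hφ hsol (hz k) (hzs k) (hzΩ k)]
      exact setIntegral_nonneg hΩ.measurableSet fun x hx =>
        mul_nonneg (sq_nonneg _) (hpos x hx _)

/-- If the null state `φ` is a positive classical solution of `Lφ = 0`, then there is a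
null sequence of compactly supported Lipschitz functions converging to `φ` locally
uniformly on `Ω ∖ {x₀}`. -/
theorem stmt16
    {d : ℕ} (hd : 1 ≤ d) (Ω : Set (EuclideanSpace ℝ (Fin d)))
    (hΩo : IsOpen Ω) (hΩc : IsConnected Ω)
    (A : EuclideanSpace ℝ (Fin d) → Matrix (Fin d) (Fin d) ℝ)
    (hAsmooth : ∀ i j, ContDiffOn ℝ 1 (fun x => A x i j) Ω)
    (hAsymm : ∀ x ∈ Ω, (A x).IsSymm)
    (hAell : ∀ K : Set (EuclideanSpace ℝ (Fin d)), K ⊆ Ω → IsCompact K →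
      ∃ lam : ℝ, 1 < lam ∧ ∀ x ∈ K, ∀ ξ : EuclideanSpace ℝ (Fin d),
        lam⁻¹ * ‖ξ‖ ^ 2 ≤ ∑ i, ∑ j, A x i j * ξ i * ξ j ∧
        ∑ i, ∑ j, A x i j * ξ i * ξ j ≤ lam * ‖ξ‖ ^ 2)
    (V : EuclideanSpace ℝ (Fin d) → ℝ) (hVc : ContinuousOn V Ω)
    (hnn : ∀ u, IsSmoothCS Ω u → 0 ≤ quadForm Ω A V u)
    (φ : EuclideanSpace ℝ (Fin d) → ℝ) (hφnull : IsNullState Ω A V φ)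
    (hφ2 : ContDiffOn ℝ 2 φ Ω) (hφpos : ∀ x ∈ Ω, 0 < φ x)
    (hφsol : ∀ x ∈ Ω, Lop A V φ x = 0)
    (x₀ : EuclideanSpace ℝ (Fin d)) (hx₀ : x₀ ∈ Ω) :
    ∃ u : ℕ → EuclideanSpace ℝ (Fin d) → ℝ,
      (∀ N, (∃ c : NNReal, LipschitzWith c (u N)) ∧ HasCompactSupport (u N) ∧
        tsupport (u N) ⊆ Ω) ∧
      Tendsto (fun N => quadForm Ω A V (u N)) atTop (nhds 0) ∧
      TendstoLocallyUniformlyOn (fun N => u N) φ atTop (Ω \ {x₀}) := by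
  have hpos : ∀ x ∈ Ω, ∀ ξ, 0 ≤ matForm (A x) ξ := by
    intro x hx ξ
    obtain ⟨lam, hlam, h⟩ := hAell {x} (singleton_subset_iff.2 hx) isCompact_singleton
    exact (by positivity : 0 ≤ lam⁻¹ * ‖ξ‖ ^ 2).trans (h x rfl ξ).1
  have : LocallyCompactSpace Ω := hΩo.locallyCompactSpace
  let K : CompactExhaustion Ω := CompactExhaustion.choice Ω
  have hKc : ∀ n, IsCompact (Subtype.val '' K n) := fun n =>
    (K.isCompact n).image continuous_subtype_val
  have hKΩ : ∀ n, Subtype.val '' K n ⊆ Ω := fun n => Subtype.coe_image_subset _ _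
  choose u hu1 hus huΩ huK hua using fun n : ℕ =>
    exists_eqOn_abs_quadForm_lt hΩo hAsmooth hAsymm hpos hφnull hφ2 hφpos hφsol (hKc n) (hKΩ n)
      (Nat.one_div_pos_of_nat (α := ℝ) (n := n))
  refine ⟨u, fun N => ⟨(hu1 N).lipschitzWith_of_hasCompactSupport (hus N) one_ne_zero, hus N,
    huΩ N⟩, squeeze_zero_norm (fun n => (hua n).le) tendsto_one_div_add_atTop_nhds_zero_nat, ?_⟩
  rw [tendstoLocallyUniformlyOn_iff_forall_isCompact
    (hΩo.sdiff isClosed_singleton)]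
  intro S hS hSc
  have hSΩ : S ⊆ Ω := hS.trans sdiff_subset
  have hS' : IsCompact (Subtype.val ⁻¹' S : Set Ω) :=
    Topology.IsInducing.subtypeVal.isCompact_preimage' hSc (by simpa using hSΩ)
  obtain ⟨n, hn⟩ := K.exists_superset_of_isCompact hS'
  intro U hU
  filter_upwards [eventually_ge_atTop n] with m hm x hx
  rw [huK m ⟨⟨x, hSΩ hx⟩, K.subset hm (hn hx), rfl⟩]
  exact refl_mem_uniformity hU
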